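/- For any nonzero integer d and any norm ‖·‖ on ℝ³, there exists a constant c₀ > 0 such that #{(a,b,c) ∈ ℤ³ : b² − 4ac = d², ‖(a,b,c)‖ < T}/(T·log T) → c₀ as T → ∞. Equivalently, the number of integral binary quadratic forms q(x,y) = ax² + bxy + cy² of discriminant d² with ‖q‖ := ‖(a,b,c)‖ < T is asymptotic to c₀·T·log T. -/

import Mathlib

noncomputable section
open Filter Topology

lemma tendsto_riemann_sum {F : ℝ → ℝ} (hF : Continuous F) {c : ℕ} (hc : c ≤ 1) :
    Tendsto (fun n : ℕ => (∑ j ∈ Finset.range (2 * n), F (-1 + ((j : ℝ) + c) / n)) / n) atTop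
      (𝓝 (∫ t in (-1 : ℝ)..1, F t)) := by
  have huc : UniformContinuousOn F (Set.Icc (-1) 1) :=
    isCompact_Icc.uniformContinuousOn_of_continuous hF.continuousOn
  rw [Metric.uniformContinuousOn_iff] at huc
  rw [Metric.tendsto_atTop]
  intro ε hε
  obtain ⟨δ, hδ, hu⟩ := huc (ε / 4) (by positivity)
  obtain ⟨N, hN⟩ := exists_nat_gt (1 / δ)
  refine ⟨N + 1, fun n hn => ?_⟩
  have hn0 : (0 : ℝ) < n := by exact_mod_cast (by omega : 0 < n)
  have hnδ : 1 / (n : ℝ) < δ := by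
    rw [div_lt_comm₀ hn0 hδ]
    exact hN.trans (by exact_mod_cast (by omega : N < n))
  set a : ℕ → ℝ := fun j => -1 + (j : ℝ) / n with ha
  have hsplit : ∑ j ∈ Finset.range (2 * n), ∫ t in (a j)..(a (j + 1)), F t
      = ∫ t in (-1 : ℝ)..1, F t := by
    rw [intervalIntegral.sum_integral_adjacent_intervals
      (fun k _ => hF.intervalIntegrable _ _)]
    congr 1
    · simp [ha]
    · simp only [ha]; push_cast; field_simp; norm_num
  have hstep : ∀ j, a (j + 1) - a j = 1 / n := by
    intro j; simp only [ha]; push_cast; ring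
  rw [← hsplit, Finset.sum_div, Real.dist_eq, ← Finset.sum_sub_distrib]
  have hterm : ∀ j ∈ Finset.range (2 * n),
      |F (-1 + ((j : ℝ) + c) / n) / n - ∫ t in (a j)..(a (j + 1)), F t| ≤ ε / 4 * (1 / n) := by
    intro j hj
    have hj' : (j : ℝ) + 1 ≤ 2 * n := by
      have := Finset.mem_range.1 hj
      exact_mod_cast (by omega : j + 1 ≤ 2 * n)
    have hle : a j ≤ a (j + 1) := by
      have := hstep j
      have : 0 < 1 / (n : ℝ) := by positivity
      linarith
    have haj : -1 ≤ a j := by simp only [ha]; linarith [show 0 ≤ (j : ℝ) / n by positivity]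
    have haj1 : a (j + 1) ≤ 1 := by
      simp only [ha]; push_cast
      have : ((j : ℝ) + 1) / n ≤ 2 := by rw [div_le_iff₀ hn0]; linarith
      linarith
    set p : ℝ := -1 + ((j : ℝ) + c) / n with hp
    have hp1 : a j ≤ p := by
      simp only [ha, hp]; gcongr; simp
    have hp2 : p ≤ a (j + 1) := by
      have hc' : (c : ℝ) ≤ 1 := by exact_mod_cast hc
      simp only [ha, hp]; push_cast; gcongr
    have hconst : F p / n = ∫ _ in (a j)..(a (j + 1)), F p := by
      rw [intervalIntegral.integral_const, hstep]; simp; ring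
    rw [hconst, ← intervalIntegral.integral_sub (by simp) (hF.intervalIntegrable _ _),
      ← Real.norm_eq_abs]
    refine (intervalIntegral.norm_integral_le_of_norm_le_const (C := ε / 4) ?_).trans ?_
    · intro x hx
      rw [Set.uIoc_of_le hle] at hx
      have := hu p ⟨by linarith, by linarith⟩ x ⟨by linarith [hx.1], by linarith [hx.2]⟩
        (by
          rw [Real.dist_eq, abs_lt]
          have := hstep j
          constructor <;> linarith [hx.1, hx.2])
      rw [Real.dist_eq] at this
      exact this.le
    · rw [hstep, abs_of_pos (by positivity)]
  calc _ ≤ ∑ j ∈ Finset.range (2 * n), ε / 4 * (1 / n) :=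
        (Finset.abs_sum_le_sum_abs _ _).trans (Finset.sum_le_sum hterm)
    _ = ε / 2 := by simp; field_simp; norm_num
    _ < ε := by linarith

/-- The integer points of sup-norm `n` in a half-open half plane. -/
def halfShell (n : ℕ) : Finset (ℤ × ℤ) :=
  (Finset.range (2 * n)).image (fun j : ℕ => ((n : ℤ), -(n : ℤ) + (j + 1))) ∪
    (Finset.range (2 * n)).image (fun j : ℕ => (-(n : ℤ) + j, (n : ℤ)))

lemma mem_halfShell {n : ℕ} {z : ℤ × ℤ} :
    z ∈ halfShell n ↔ (z.1 = n ∧ -(n : ℤ) < z.2 ∧ z.2 ≤ n) ∨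
      (z.2 = n ∧ -(n : ℤ) ≤ z.1 ∧ z.1 < n) := by
  obtain ⟨x, y⟩ := z
  simp only [halfShell, Finset.mem_union, Finset.mem_image, Finset.mem_range, Prod.mk.injEq]
  constructor
  · rintro (⟨j, hj, h1, h2⟩ | ⟨j, hj, h1, h2⟩) <;> omega
  · rintro (⟨h1, h2, h3⟩ | ⟨h1, h2, h3⟩)
    · exact Or.inl ⟨(y + n - 1).toNat, by omega, by omega, by omega⟩
    · exact Or.inr ⟨(x + n).toNat, by omega, by omega, by omega⟩

lemma sum_halfShell (n : ℕ) (f : ℤ × ℤ → ℝ) :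
    ∑ z ∈ halfShell n, f z = ∑ j ∈ Finset.range (2 * n), f ((n : ℤ), -(n : ℤ) + (j + 1)) +
      ∑ j ∈ Finset.range (2 * n), f (-(n : ℤ) + j, (n : ℤ)) := by
  rw [halfShell, Finset.sum_union, Finset.sum_image, Finset.sum_image]
  · intro i _ j _ h; simp at h; omega
  · intro i _ j _ h; simp at h; omega
  · rw [Finset.disjoint_left]
    simp only [Finset.mem_image, Finset.mem_range]
    rintro _ ⟨i, hi, rfl⟩ ⟨j, hj, h⟩
    simp at h; omega

lemma tendsto_sum_halfShell {H : ℝ → ℝ → ℝ}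
    (hom : ∀ c x y, c ≠ 0 → H (c * x) (c * y) = H x y / c ^ 2)
    (h1 : Continuous (H 1)) (h2 : Continuous fun x => H x 1) :
    Tendsto (fun n : ℕ => n * ∑ z ∈ halfShell n, H z.1 z.2) atTop
      (𝓝 ((∫ t in (-1 : ℝ)..1, H 1 t) + ∫ t in (-1 : ℝ)..1, H t 1)) := by
  refine ((tendsto_riemann_sum h1 (c := 1) le_rfl).add
    (tendsto_riemann_sum h2 (c := 0) zero_le_one)).congr' ?_
  filter_upwards [eventually_gt_atTop 0] with n hn
  have hn0 : (n : ℝ) ≠ 0 := by positivity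
  rw [sum_halfShell, mul_add, Finset.mul_sum, Finset.mul_sum, Finset.sum_div, Finset.sum_div]
  congr 1 <;> refine Finset.sum_congr rfl fun j _ => ?_
  · have : H (((n : ℤ) : ℝ)) ((-(n : ℤ) + (j + 1) : ℤ) : ℝ)
        = H (n * 1) (n * (-1 + ((j : ℝ) + (1 : ℕ)) / n)) := by
      congr 1
      · simp
      · push_cast; field_simp
    simp only
    rw [this, hom _ _ _ hn0]; field_simp
  · have : H ((-(n : ℤ) + j : ℤ) : ℝ) (((n : ℤ) : ℝ))
        = H (n * (-1 + ((j : ℝ) + (0 : ℕ)) / n)) (n * 1) := by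
      congr 1
      · push_cast; field_simp; ring
      · simp
    simp only
    rw [this, hom _ _ _ hn0]; field_simp

lemma tendsto_sum_div_log {a : ℕ → ℝ} {L : ℝ} (ha : Tendsto (fun n : ℕ => n * a n) atTop (𝓝 L)) :
    Tendsto (fun M : ℕ => (∑ n ∈ Finset.Ioc 0 M, a n) / Real.log M) atTop (𝓝 L) := by
  have hsum : ∀ (f : ℕ → ℝ) (M : ℕ), ∑ n ∈ Finset.Ioc 0 M, f n = ∑ i ∈ Finset.range M, f (i + 1) := by
    intro f M
    induction M with
    | zero => simp
    | succ M ih => rw [Finset.sum_Ioc_succ_top (Nat.zero_le M), Finset.sum_range_succ, ih]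
  have hharm : ∀ M : ℕ, ∑ i ∈ Finset.range M, 1 / ((i : ℝ) + 1) = harmonic M := by
    intro M; simp [harmonic]
  have hlog : Tendsto (fun M : ℕ => Real.log M) atTop atTop :=
    Real.tendsto_log_atTop.comp tendsto_natCast_atTop_atTop
  have hratio : Tendsto (fun M : ℕ => (harmonic M : ℝ) / Real.log M) atTop (𝓝 1) := by
    have := (Real.tendsto_harmonic_sub_log.div_atTop hlog).add_const 1
    rw [zero_add] at this
    refine this.congr' ?_
    filter_upwards [eventually_gt_atTop 1] with M hM
    have : 0 < Real.log M := Real.log_pos (by exact_mod_cast hM)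
    field_simp; ring
  have hharm_top : Tendsto (fun M : ℕ => ∑ i ∈ Finset.range M, 1 / ((i : ℝ) + 1)) atTop atTop := by
    simp_rw [hharm]
    have := Real.tendsto_harmonic_sub_log.add_atTop hlog
    simpa using this
  have hlo : (fun i : ℕ => a (i + 1) - L * (1 / ((i : ℝ) + 1))) =o[atTop]
      fun i : ℕ => 1 / ((i : ℝ) + 1) := by
    rw [Asymptotics.isLittleO_iff_tendsto]
    · have := ((tendsto_add_atTop_iff_nat 1).2 ha).sub_const L
      rw [sub_self] at this
      refine this.congr fun i => ?_
      have : (i : ℝ) + 1 ≠ 0 := by positivity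
      push_cast; field_simp
    · intro i hi
      have : (1 : ℝ) / (i + 1) ≠ 0 := by positivity
      exact absurd hi this
  have hS := hlo.sum_range (fun i => by simp only [Pi.zero_apply]; positivity) hharm_top
  have hS' := hS.tendsto_div_nhds_zero
  have := ((hS'.add_const L).mul hratio)
  rw [zero_add, mul_one] at this
  refine this.congr' ?_
  filter_upwards [eventually_gt_atTop 1, hharm_top.eventually_gt_atTop 0] with M hM hpos
  have : 0 < Real.log M := Real.log_pos (by exact_mod_cast hM)
  rw [hsum, ← hharm, Finset.sum_sub_distrib, ← Finset.mul_sum]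
  field_simp
  ring

/-- The primitive points of `halfShell n`. -/
def primShell (n : ℕ) : Finset (ℤ × ℤ) :=
  (halfShell n).filter fun z => Int.gcd z.1 z.2 = 1

lemma halfShell_zero : halfShell 0 = ∅ := by simp [halfShell]

lemma mul_mem_halfShell {g m : ℕ} (hg : 0 < g) {w : ℤ × ℤ} :
    ((g : ℤ) * w.1, (g : ℤ) * w.2) ∈ halfShell (g * m) ↔ w ∈ halfShell m := by
  have hg' : (0 : ℤ) < g := by exact_mod_cast hg
  simp only [mem_halfShell, Nat.cast_mul, ← mul_neg]
  simp only [mul_lt_mul_iff_right₀ hg', mul_le_mul_iff_right₀ hg', mul_right_inj' hg'.ne']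

lemma gcd_dvd_of_mem_halfShell {n : ℕ} {z : ℤ × ℤ} (hz : z ∈ halfShell n) :
    Int.gcd z.1 z.2 ∣ n := by
  rcases mem_halfShell.1 hz with ⟨h, -⟩ | ⟨h, -⟩
  · have := Int.gcd_dvd_left z.1 z.2
    rw [h] at this ⊢
    exact_mod_cast this
  · have := Int.gcd_dvd_right z.1 z.2
    rw [h] at this ⊢
    exact_mod_cast this

lemma sum_halfShell_gcd_eq {H : ℝ → ℝ → ℝ}
    (hom : ∀ c x y, c ≠ 0 → H (c * x) (c * y) = H x y / c ^ 2) {g m : ℕ} (hg : 0 < g) :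
    ∑ z ∈ (halfShell (g * m)).filter (fun z => Int.gcd z.1 z.2 = g), H z.1 z.2
      = (∑ w ∈ primShell m, H w.1 w.2) / (g : ℝ) ^ 2 := by
  have hg' : (0 : ℤ) < g := by exact_mod_cast hg
  rw [Finset.sum_div]
  symm
  refine Finset.sum_nbij (fun w => ((g : ℤ) * w.1, (g : ℤ) * w.2)) ?_ ?_ ?_ ?_
  · intro w hw
    obtain ⟨hw, hc⟩ := Finset.mem_filter.1 hw
    refine Finset.mem_filter.2 ⟨(mul_mem_halfShell hg).2 hw, ?_⟩
    simp [Int.gcd_mul_left, hc]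
  · intro w _ w' _ h
    simp only [Prod.mk.injEq, mul_right_inj' hg'.ne'] at h
    exact Prod.ext h.1 h.2
  · intro z hz
    obtain ⟨hz, hc⟩ := Finset.mem_filter.1 (Finset.mem_coe.1 hz)
    obtain ⟨a, ha⟩ : (g : ℤ) ∣ z.1 := hc ▸ Int.gcd_dvd_left z.1 z.2
    obtain ⟨b, hb⟩ : (g : ℤ) ∣ z.2 := hc ▸ Int.gcd_dvd_right z.1 z.2
    have hzeq : z = ((g : ℤ) * (a, b).1, (g : ℤ) * (a, b).2) := Prod.ext ha hb
    refine ⟨(a, b), Finset.mem_coe.2 (Finset.mem_filter.2 ⟨?_, ?_⟩), hzeq.symm⟩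
    · rw [hzeq] at hz
      exact (mul_mem_halfShell hg).1 hz
    · rw [ha, hb, Int.gcd_mul_left] at hc
      simpa [hg.ne'] using hc
  · intro w _
    push_cast
    rw [hom _ _ _ (by positivity)]

lemma sq_mul_sum_halfShell {H : ℝ → ℝ → ℝ}
    (hom : ∀ c x y, c ≠ 0 → H (c * x) (c * y) = H x y / c ^ 2) {n : ℕ} (hn : 0 < n) :
    ∑ m ∈ n.divisors, (m : ℝ) ^ 2 * ∑ w ∈ primShell m, H w.1 w.2
      = (n : ℝ) ^ 2 * ∑ z ∈ halfShell n, H z.1 z.2 := by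
  rw [← Nat.sum_div_divisors n, Finset.mul_sum,
    ← Finset.sum_fiberwise_of_maps_to (t := n.divisors) (g := fun z => Int.gcd z.1 z.2)
      (fun z hz => Nat.mem_divisors.2 ⟨gcd_dvd_of_mem_halfShell hz, hn.ne'⟩)]
  refine Finset.sum_congr rfl fun g hg => ?_
  obtain ⟨m, rfl⟩ := (Nat.mem_divisors.1 hg).1
  have hg0 : 0 < g := Nat.pos_of_mem_divisors hg
  rw [Nat.mul_div_cancel_left _ hg0, ← Finset.mul_sum, sum_halfShell_gcd_eq hom hg0]
  have : (g : ℝ) ≠ 0 := by positivity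
  push_cast
  field_simp

lemma sum_primShell_eq {H : ℝ → ℝ → ℝ}
    (hom : ∀ c x y, c ≠ 0 → H (c * x) (c * y) = H x y / c ^ 2) (M : ℕ) :
    ∑ n ∈ Finset.Ioc 0 M, ∑ w ∈ primShell n, H w.1 w.2
      = ∑ g ∈ Finset.Ioc 0 M, (ArithmeticFunction.moebius g : ℝ) / (g : ℝ) ^ 2 *
          ∑ m ∈ Finset.Ioc 0 (M / g), ∑ z ∈ halfShell m, H z.1 z.2 := by
  let f : ArithmeticFunction ℝ := ⟨fun g => (ArithmeticFunction.moebius g : ℝ) / (g : ℝ) ^ 2, by simp⟩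
  let a : ArithmeticFunction ℝ := ⟨fun m => ∑ z ∈ halfShell m, H z.1 z.2, by simp [halfShell_zero]⟩
  have key := ArithmeticFunction.sum_Ioc_mul_eq_sum_sum f a M
  have hmul : ∀ n ∈ Finset.Ioc 0 M, (f * a) n = ∑ w ∈ primShell n, H w.1 w.2 := by
    intro n hn
    have hn0 : 0 < n := (Finset.mem_Ioc.1 hn).1
    have h := ArithmeticFunction.sum_eq_iff_sum_mul_moebius_eq.1
      (fun n hn => sq_mul_sum_halfShell hom (n := n) hn) n hn0
    have hn' : (n : ℝ) ≠ 0 := by positivity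
    rw [ArithmeticFunction.mul_apply]
    apply mul_left_cancel₀ (pow_ne_zero 2 hn')
    rw [← h, Finset.mul_sum]
    refine Finset.sum_congr rfl fun x hx => ?_
    obtain ⟨hx1, hx2⟩ := Nat.mem_divisorsAntidiagonal.1 hx
    have : (x.1 : ℝ) ≠ 0 := by
      have : x.1 ≠ 0 := by rintro h0; simp [h0] at hx1; omega
      exact_mod_cast this
    simp only [f, a, ArithmeticFunction.coe_mk]
    rw [← hx1]; push_cast; field_simp
  rw [← Finset.sum_congr rfl hmul]
  exact key

lemma summable_moebius_div_sq :
    Summable fun g : ℕ => (ArithmeticFunction.moebius g : ℝ) / (g : ℝ) ^ 2 := by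
  refine Summable.of_norm_bounded hasSum_zeta_two.summable fun g => ?_
  rw [norm_div, norm_pow, Real.norm_natCast]
  gcongr
  have := ArithmeticFunction.abs_moebius_le_one (n := g)
  rw [Real.norm_eq_abs]
  exact_mod_cast this

lemma tsum_moebius_div_sq_pos :
    0 < ∑' g : ℕ, (ArithmeticFunction.moebius g : ℝ) / (g : ℝ) ^ 2 := by
  have hs := summable_moebius_div_sq
  have hz := hasSum_zeta_two
  have hle : ∑' g : ℕ, (if g = 1 then (2 : ℝ) else 0) - Real.pi ^ 2 / 6
      ≤ ∑' g : ℕ, (ArithmeticFunction.moebius g : ℝ) / (g : ℝ) ^ 2 := by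
    have h1 : HasSum (fun g : ℕ => if g = 1 then (2 : ℝ) else 0) 2 := hasSum_ite_eq 1 2
    rw [h1.tsum_eq]
    refine hasSum_le (fun g => ?_) (h1.sub hz) hs.hasSum
    split_ifs with hg
    · subst hg; simp; norm_num
    · have h2 := ArithmeticFunction.abs_moebius_le_one (n := g)
      have h3 : (-1 : ℝ) ≤ (ArithmeticFunction.moebius g : ℝ) := by
        exact_mod_cast (abs_le.1 h2).1
      rw [zero_sub, ← neg_div]
      gcongr
  rw [tsum_ite_eq] at hle
  have hpi := Real.pi_lt_d2
  have hpi0 := Real.pi_pos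
  nlinarith

lemma tendsto_log_natDiv {g : ℕ} (hg : 0 < g) :
    Tendsto (fun M : ℕ => Real.log ((M / g : ℕ) : ℝ) / Real.log M) atTop (𝓝 1) := by
  have hlog : Tendsto (fun M : ℕ => Real.log M) atTop atTop :=
    Real.tendsto_log_atTop.comp tendsto_natCast_atTop_atTop
  have h0 : Tendsto (fun M : ℕ => (Real.log (2 * g)) / Real.log M) atTop (𝓝 0) :=
    tendsto_const_nhds.div_atTop hlog
  have h1 := h0.const_sub 1
  rw [sub_zero] at h1
  refine tendsto_of_tendsto_of_tendsto_of_le_of_le' h1 tendsto_const_nhds ?_ ?_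
  · filter_upwards [eventually_gt_atTop 1, eventually_ge_atTop g] with M hM hMg
    have hl : 0 < Real.log M := Real.log_pos (by exact_mod_cast hM)
    have hM0 : (0 : ℝ) < M := by positivity
    have hg0 : (0 : ℝ) < g := by exact_mod_cast hg
    rw [one_sub_div hl.ne', ← Real.log_div (by positivity) (by positivity)]
    gcongr
    rw [div_le_iff₀ (by positivity)]
    have h2 : M ≤ (M / g) * (2 * g) := by
      have := Nat.div_add_mod M g
      have := Nat.mod_lt M hg
      have := Nat.div_pos hMg hg
      nlinarith
    exact_mod_cast h2
  · filter_upwards [eventually_gt_atTop 1, eventually_ge_atTop g] with M hM hMg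
    have hl : 0 < Real.log M := Real.log_pos (by exact_mod_cast hM)
    rw [div_le_one hl]
    have := Nat.div_pos hMg hg
    apply Real.log_le_log (by exact_mod_cast this)
    exact_mod_cast Nat.div_le_self M g

lemma exists_tendsto_sum_primShell_div_log {H : ℝ → ℝ → ℝ}
    (hom : ∀ c x y, c ≠ 0 → H (c * x) (c * y) = H x y / c ^ 2)
    (h1 : Continuous (H 1)) (h2 : Continuous fun x => H x 1)
    (hnn : ∀ x y, 0 ≤ H x y) (hp1 : ∀ t, 0 < H 1 t) (hp2 : ∀ t, 0 < H t 1) :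
    ∃ c > 0, Tendsto (fun M : ℕ =>
      (∑ n ∈ Finset.Ioc 0 M, ∑ w ∈ primShell n, H w.1 w.2) / Real.log M) atTop (𝓝 c) := by
  set L := (∫ t in (-1 : ℝ)..1, H 1 t) + ∫ t in (-1 : ℝ)..1, H t 1 with hL
  have hLpos : 0 < L := add_pos
    (intervalIntegral.intervalIntegral_pos_of_pos (h1.intervalIntegrable _ _) hp1 (by norm_num))
    (intervalIntegral.intervalIntegral_pos_of_pos (h2.intervalIntegrable _ _) hp2 (by norm_num))
  set A : ℕ → ℝ := fun M => ∑ m ∈ Finset.Ioc 0 M, ∑ z ∈ halfShell m, H z.1 z.2 with hA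
  have hAlim : Tendsto (fun M : ℕ => A M / Real.log M) atTop (𝓝 L) :=
    tendsto_sum_div_log (tendsto_sum_halfShell hom h1 h2)
  have hAmono : Monotone A := fun M M' h =>
    Finset.sum_le_sum_of_subset_of_nonneg (Finset.Ioc_subset_Ioc_right h)
      fun _ _ _ => Finset.sum_nonneg fun _ _ => hnn _ _
  have hAnn : ∀ M, 0 ≤ A M := fun M =>
    Finset.sum_nonneg fun _ _ => Finset.sum_nonneg fun _ _ => hnn _ _
  refine ⟨(∑' g : ℕ, (ArithmeticFunction.moebius g : ℝ) / (g : ℝ) ^ 2) * L,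
    mul_pos tsum_moebius_div_sq_pos hLpos, ?_⟩
  rw [← tsum_mul_right]
  have key : Tendsto (fun M : ℕ => ∑' g : ℕ, (ArithmeticFunction.moebius g : ℝ) / (g : ℝ) ^ 2 *
      (A (M / g) / Real.log M)) atTop
      (𝓝 (∑' g : ℕ, (ArithmeticFunction.moebius g : ℝ) / (g : ℝ) ^ 2 * L)) := by
    refine tendsto_tsum_of_dominated_convergence
      (bound := fun g : ℕ => 1 / (g : ℝ) ^ 2 * (L + 1))
      (hasSum_zeta_two.summable.mul_right _) (fun g => ?_) ?_
    · rcases Nat.eq_zero_or_pos g with rfl | hg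
      · simp
      · refine Tendsto.const_mul _ ?_
        have hdiv : Tendsto (fun M : ℕ => M / g) atTop atTop := Nat.tendsto_div_const_atTop hg.ne'
        have := (hAlim.comp hdiv).mul (tendsto_log_natDiv hg)
        rw [mul_one] at this
        refine this.congr' ?_
        filter_upwards [hdiv.eventually_gt_atTop 1] with M hM
        have : Real.log ((M / g : ℕ) : ℝ) ≠ 0 := (Real.log_pos (by exact_mod_cast hM)).ne'
        simp only [Function.comp]
        rw [div_mul_div_comm, mul_comm (Real.log _) (Real.log (M : ℝ)), mul_div_mul_right _ _ this]
    · filter_upwards [hAlim.eventually_le_const (lt_add_one L), eventually_gt_atTop 1] with M hM hM1 g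
      have hl : 0 < Real.log M := Real.log_pos (by exact_mod_cast hM1)
      rw [norm_mul, norm_div, norm_pow, Real.norm_natCast,
        Real.norm_of_nonneg (div_nonneg (hAnn _) hl.le)]
      have hμ : ‖(ArithmeticFunction.moebius g : ℝ)‖ ≤ 1 := by
        rw [Real.norm_eq_abs]
        exact_mod_cast ArithmeticFunction.abs_moebius_le_one (n := g)
      have hAg : A (M / g) / Real.log M ≤ L + 1 :=
        (div_le_div_of_nonneg_right (hAmono (Nat.div_le_self M g)) hl.le).trans hM
      exact mul_le_mul (by gcongr) hAg (div_nonneg (hAnn _) hl.le) (by positivity)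
  refine key.congr fun M => ?_
  rw [sum_primShell_eq hom, Finset.sum_div, tsum_eq_sum (s := Finset.Ioc 0 M)]
  · exact Finset.sum_congr rfl fun g _ => by rw [mul_div_assoc]
  · intro g hg
    have : M / g = 0 := by
      simp only [Finset.mem_Ioc, not_and, not_le] at hg
      rcases Nat.eq_zero_or_pos g with rfl | h
      · simp
      · exact Nat.div_eq_of_lt (hg h)
    simp [this, hA]

lemma Seminorm.le_sum_of_abs_le (nrm : Seminorm ℝ (Fin 3 → ℝ)) {v : Fin 3 → ℝ} {a : ℝ}
    (hv : ∀ i, |v i| ≤ a) : nrm v ≤ a * ∑ i, nrm (Pi.single i 1) := by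
  have hdec : v = ∑ i, v i • (Pi.single i 1 : Fin 3 → ℝ) := by
    ext j; simp [Finset.sum_apply, Pi.single_apply]
  calc nrm v = nrm (∑ i, v i • (Pi.single i 1 : Fin 3 → ℝ)) := by rw [← hdec]
    _ ≤ ∑ i, nrm (v i • (Pi.single i 1 : Fin 3 → ℝ)) :=
        Finset.le_sum_of_subadditive nrm (map_zero nrm).le (map_add_le_add nrm) _ _
    _ ≤ ∑ i, a * nrm (Pi.single i 1) := by
        refine Finset.sum_le_sum fun i _ => ?_
        rw [map_smul_eq_mul, Real.norm_eq_abs]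
        exact mul_le_mul_of_nonneg_right (hv i) (apply_nonneg _ _)
    _ = _ := by rw [Finset.mul_sum]

lemma Seminorm.continuous_fin_three (nrm : Seminorm ℝ (Fin 3 → ℝ)) : Continuous nrm := by
  set B := ∑ i, nrm (Pi.single i 1)
  have hB : 0 ≤ B := Finset.sum_nonneg fun _ _ => apply_nonneg _ _
  refine (LipschitzWith.of_dist_le_mul (K := ⟨B, hB⟩) fun v w => ?_).continuous
  rw [Real.dist_eq, dist_eq_norm]
  refine (abs_sub_map_le_sub nrm v w).trans ?_
  rw [mul_comm]
  exact nrm.le_sum_of_abs_le fun i => norm_le_pi_norm (v - w) i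

lemma Seminorm.exists_mul_abs_le (nrm : Seminorm ℝ (Fin 3 → ℝ)) (hnrm : ∀ v, nrm v = 0 → v = 0) :
    ∃ c > 0, ∀ (v : Fin 3 → ℝ) (i : Fin 3), c * |v i| ≤ nrm v := by
  have hS : IsCompact (Metric.sphere (0 : Fin 3 → ℝ) 1) := isCompact_sphere 0 1
  obtain ⟨u, hu, hmin⟩ := hS.exists_isMinOn (NormedSpace.sphere_nonempty.2 zero_le_one)
    nrm.continuous_fin_three.continuousOn
  have hu0 : u ≠ 0 := by
    rintro rfl; simp at hu
  have hpos : 0 < nrm u := lt_of_le_of_ne (apply_nonneg _ _) fun h => hu0 (hnrm u h.symm)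
  refine ⟨nrm u, hpos, fun v i => ?_⟩
  rcases eq_or_ne v 0 with rfl | hv
  · simp
  have hv' : 0 < ‖v‖ := norm_pos_iff.2 hv
  have h1 : nrm u ≤ nrm (‖v‖⁻¹ • v) := hmin (by simp [norm_smul, hv'.ne'])
  rw [map_smul_eq_mul, norm_inv, norm_norm, inv_mul_eq_div, le_div_iff₀ hv'] at h1
  exact (mul_le_mul_of_nonneg_left (norm_le_pi_norm v i) hpos.le).trans h1

/-- The coefficients of `(yX - xY)²`, where `z = (x, y)`. -/
def sqForm (x y : ℝ) : Fin 3 → ℝ := ![y ^ 2, -2 * x * y, x ^ 2]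

lemma sqForm_mul (c x y : ℝ) : sqForm (c * x) (c * y) = c ^ 2 • sqForm x y := by
  ext i; fin_cases i <;> simp [sqForm] <;> ring

/-- The coefficients of `(yX - xY)(pX + rY)`, where `z = (x, y)`. -/
def prodForm (z : ℤ × ℤ) (p r : ℤ) : Fin 3 → ℤ := ![z.2 * p, z.2 * r - z.1 * p, -(z.1 * r)]

/-- The form with coefficients `q` vanishes at `z`. -/
def IsFormRoot (q : Fin 3 → ℤ) (z : ℤ × ℤ) : Prop :=
  q 0 * z.1 ^ 2 + q 1 * z.1 * z.2 + q 2 * z.2 ^ 2 = 0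

lemma isFormRoot_prodForm {z w : ℤ × ℤ} {p r : ℤ} :
    IsFormRoot (prodForm z p r) w ↔
      z.2 * w.1 - z.1 * w.2 = 0 ∨ p * w.1 + r * w.2 = 0 := by
  rw [← mul_eq_zero]
  simp only [IsFormRoot, prodForm, Matrix.cons_val]
  constructor <;> intro h <;> linear_combination h

lemma disc_prodForm (z : ℤ × ℤ) (p r : ℤ) :
    (prodForm z p r 1) ^ 2 - 4 * (prodForm z p r 0) * (prodForm z p r 2)
      = (z.1 * p + z.2 * r) ^ 2 := by
  simp only [prodForm, Matrix.cons_val]; ring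

lemma bounds_of_mem_halfShell {n : ℕ} {z : ℤ × ℤ} (hz : z ∈ halfShell n) :
    0 < n ∧ |z.1| ≤ n ∧ |z.2| ≤ n ∧ (n : ℤ) ^ 2 ≤ z.1 ^ 2 + z.2 ^ 2 ∧
      (z.1.natAbs = n ∨ z.2.natAbs = n) := by
  rw [abs_le, abs_le]
  rcases mem_halfShell.1 hz with ⟨h1, h2, h3⟩ | ⟨h1, h2, h3⟩
  · refine ⟨by omega, ⟨by omega, by omega⟩, ⟨by omega, by omega⟩, ?_, by omega⟩
    rw [h1]; nlinarith [sq_nonneg z.2]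
  · refine ⟨by omega, ⟨by omega, by omega⟩, ⟨by omega, by omega⟩, ?_, by omega⟩
    rw [h1]; nlinarith [sq_nonneg z.1]

lemma exists_bezout_of_mem_primShell {n : ℕ} {z : ℤ × ℤ} (hz : z ∈ primShell n) :
    ∃ s t : ℤ, z.1 * s + z.2 * t = 1 := by
  obtain ⟨s, t, h⟩ := Int.isCoprime_iff_gcd_eq_one.2 (Finset.mem_filter.1 hz).2
  exact ⟨s, t, by linear_combination h⟩

lemma exists_mem_primShell {u v : ℤ} (h : u ≠ 0 ∨ v ≠ 0) :
    ∃ n, ∃ z ∈ primShell n, ∃ g : ℤ, g ≠ 0 ∧ u = g * z.1 ∧ v = g * z.2 := by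
  have hg : 0 < Int.gcd u v := Int.gcd_pos_iff.2 h
  obtain ⟨u', hu⟩ := Int.gcd_dvd_left u v
  obtain ⟨v', hv⟩ := Int.gcd_dvd_right u v
  have hg' : ((Int.gcd u v : ℕ) : ℤ) ≠ 0 := by exact_mod_cast hg.ne'
  have hcop : Int.gcd u' v' = 1 := by
    have h1 : Int.gcd u v = Int.gcd u v * Int.gcd u' v' := by
      have h2 := Int.gcd_mul_left (Int.gcd u v) u' v'
      rwa [← hu, ← hv, Int.natAbs_natCast] at h2
    exact Nat.eq_of_mul_eq_mul_left hg (by omega)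
  have hne : u' ≠ 0 ∨ v' ≠ 0 := by
    by_contra! h0
    rw [h0.1, h0.2] at hcop; simp at hcop
  have hcases : (u', v') ∈ halfShell (max u'.natAbs v'.natAbs) ∨
      (-u', -v') ∈ halfShell (max u'.natAbs v'.natAbs) := by
    simp only [mem_halfShell]; omega
  rcases hcases with hm | hm
  · exact ⟨_, (u', v'), Finset.mem_filter.2 ⟨hm, hcop⟩, _, hg', hu, hv⟩
  · refine ⟨_, (-u', -v'), Finset.mem_filter.2 ⟨hm, by simpa using hcop⟩, -(Int.gcd u v : ℤ),
      neg_ne_zero.2 hg', ?_, ?_⟩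
    · linear_combination hu
    · linear_combination hv

lemma eq_of_mem_primShell {n m : ℕ} {z w : ℤ × ℤ} (hz : z ∈ primShell n) (hw : w ∈ primShell m)
    (h : z.2 * w.1 - z.1 * w.2 = 0) : z = w := by
  obtain ⟨s, t, hst⟩ := exists_bezout_of_mem_primShell hz
  obtain ⟨hz1, -⟩ := Finset.mem_filter.1 hz
  obtain ⟨hw1, hw2⟩ := Finset.mem_filter.1 hw
  have h1 : w.1 = (w.1 * s + w.2 * t) * z.1 := by linear_combination (-w.1) * hst + t * h
  have h2 : w.2 = (w.1 * s + w.2 * t) * z.2 := by linear_combination (-w.2) * hst - s * h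
  set e := w.1 * s + w.2 * t
  have he : e.natAbs = 1 := by
    rw [h1, h2, Int.gcd_mul_left, (Finset.mem_filter.1 hz).2] at hw2
    simpa using hw2
  rcases Int.natAbs_eq_iff.1 he with he | he
  · rw [he] at h1 h2
    exact Prod.ext (by simpa using h1.symm) (by simpa using h2.symm)
  · rw [he] at h1 h2
    rw [mem_halfShell] at hz1 hw1
    omega

lemma eq_prodForm_of_isFormRoot {n : ℕ} {z : ℤ × ℤ} (hz : z ∈ primShell n) {q : Fin 3 → ℤ}
    (h : IsFormRoot q z) : ∃ p r, q = prodForm z p r := by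
  obtain ⟨s, t, hst⟩ := exists_bezout_of_mem_primShell hz
  obtain ⟨x, y⟩ := z
  simp only [IsFormRoot] at h hst
  refine ⟨2 * x * s * t * q 0 + y * t ^ 2 * q 0 - s ^ 2 * (y * q 2 + q 1 * x),
    t ^ 2 * (y * q 1 + x * q 0) - 2 * y * s * t * q 2 - x * s ^ 2 * q 2, ?_⟩
  ext i
  fin_cases i <;> simp only [prodForm, Matrix.cons_val, Fin.zero_eta, Fin.mk_one, Fin.reduceFinMk]
  · linear_combination (-q 0 * (x * s + y * t + 1)) * hst + s ^ 2 * h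
  · linear_combination (-q 1 * (x * s + y * t + 1)) * hst + 2 * s * t * h
  · linear_combination (-q 2 * (x * s + y * t + 1)) * hst + t ^ 2 * h

lemma exists_isFormRoot {q : Fin 3 → ℤ} {d : ℤ}
    (h : (q 1) ^ 2 - 4 * (q 0) * (q 2) = d ^ 2) : ∃ n, ∃ z ∈ primShell n, IsFormRoot q z := by
  obtain ⟨u, v, huv, hr⟩ : ∃ u v : ℤ, (u ≠ 0 ∨ v ≠ 0) ∧
      q 0 * u ^ 2 + q 1 * u * v + q 2 * v ^ 2 = 0 := by
    by_cases h0 : q 0 = 0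
    · exact ⟨1, 0, by simp, by simp [h0]⟩
    · exact ⟨d - q 1, 2 * q 0, Or.inr (by simpa using h0), by linear_combination (-q 0) * h⟩
  obtain ⟨n, z, hz, g, hg, rfl, rfl⟩ := exists_mem_primShell huv
  refine ⟨n, z, hz, ?_⟩
  apply mul_left_cancel₀ (pow_ne_zero 2 hg)
  linear_combination hr

/-- Every form of square discriminant has a root of minimal height. -/
lemma exists_min_isFormRoot {q : Fin 3 → ℤ} {d : ℤ}
    (h : (q 1) ^ 2 - 4 * (q 0) * (q 2) = d ^ 2) :
    ∃ z : ℤ × ℤ, ∃ n, z ∈ primShell n ∧ IsFormRoot q z ∧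
      ∀ m, ∀ w ∈ primShell m, IsFormRoot q w → n ≤ m := by
  classical
  have hex := exists_isFormRoot h
  obtain ⟨z, hz, hr⟩ := Nat.find_spec hex
  exact ⟨z, _, hz, hr, fun m w hw hwr => Nat.find_min' hex ⟨w, hw, hwr⟩⟩

/-- The coordinate `τ` with `(p, r) = δ (x, y) / |z|² + τ (y, -x)`, for `δ = px + ry`. -/
def lineCoord (z : ℤ × ℤ) (p r : ℤ) : ℝ :=
  ((p : ℝ) * z.2 - r * z.1) / ((z.1 : ℝ) ^ 2 + (z.2 : ℝ) ^ 2)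

lemma exists_abs_prodForm_sub_le (nrm : Seminorm ℝ (Fin 3 → ℝ)) :
    ∃ B, 0 ≤ B ∧ ∀ n, ∀ z ∈ halfShell n, ∀ p r : ℤ,
      |nrm (fun i => (prodForm z p r i : ℝ)) - |lineCoord z p r| * nrm (sqForm z.1 z.2)|
        ≤ |((z.1 * p + z.2 * r : ℤ) : ℝ)| * B := by
  refine ⟨1 * ∑ i, nrm (Pi.single i 1),
    mul_nonneg zero_le_one (Finset.sum_nonneg fun _ _ => apply_nonneg _ _), ?_⟩
  rintro n ⟨x, y⟩ hz p r
  obtain ⟨hn, -, -, hD, -⟩ := bounds_of_mem_halfShell hz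
  simp only at hD ⊢
  have hD' : (0 : ℝ) < (x : ℝ) ^ 2 + (y : ℝ) ^ 2 := by
    have : (0 : ℤ) < x ^ 2 + y ^ 2 := lt_of_lt_of_le (by positivity) hD
    exact_mod_cast this
  set D := (x : ℝ) ^ 2 + (y : ℝ) ^ 2 with hDdef
  have hdec : (fun i => (prodForm (x, y) p r i : ℝ))
      = lineCoord (x, y) p r • sqForm x y
        + ((x * p + y * r : ℤ) : ℝ) • (![x * y / D, (y ^ 2 - x ^ 2) / D, -(x * y) / D] : Fin 3 → ℝ) := by
    ext i
    fin_cases i <;>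
      simp [prodForm, lineCoord, sqForm, ← hDdef] <;> field_simp <;> rw [hDdef] <;> ring
  have hB : nrm (![x * y / D, (y ^ 2 - x ^ 2) / D, -(x * y) / D] : Fin 3 → ℝ)
      ≤ 1 * ∑ i, nrm (Pi.single i 1) := by
    refine nrm.le_sum_of_abs_le fun i => ?_
    fin_cases i <;> simp only [Matrix.cons_val, Fin.zero_eta, Fin.mk_one, Fin.reduceFinMk] <;>
      rw [abs_div, abs_of_pos hD', div_le_one hD', abs_le] <;>
      constructor <;> nlinarith [sq_nonneg ((x : ℝ) + y), sq_nonneg ((x : ℝ) - y), sq_nonneg (x : ℝ),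
        sq_nonneg (y : ℝ)]
  have h1 := abs_sub_map_le_sub nrm (fun i => (prodForm (x, y) p r i : ℝ))
    (lineCoord (x, y) p r • sqForm x y)
  rw [map_smul_eq_mul, Real.norm_eq_abs] at h1
  refine h1.trans ?_
  rw [hdec, add_sub_cancel_left, map_smul_eq_mul, Real.norm_eq_abs]
  exact mul_le_mul_of_nonneg_left hB (abs_nonneg _)

/-- The integers `k` with `|k + τ| < X`. -/
def shiftBall (τ X : ℝ) : Finset ℤ := Finset.Ioo ⌊-X - τ⌋ ⌈X - τ⌉

lemma mem_shiftBall {τ X : ℝ} {k : ℤ} : k ∈ shiftBall τ X ↔ |(k : ℝ) + τ| < X := by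
  rw [shiftBall, Finset.mem_Ioo, Int.floor_lt, Int.lt_ceil, abs_lt]
  constructor <;> rintro ⟨h1, h2⟩ <;> constructor <;> linarith

lemma le_card_shiftBall (τ X : ℝ) : 2 * X - 1 ≤ (shiftBall τ X).card := by
  rw [shiftBall, Int.card_Ioo]
  have h1 := Int.floor_le (-X - τ)
  have h2 := Int.le_ceil (X - τ)
  have h3 : ((⌈X - τ⌉ - ⌊-X - τ⌋ - 1 : ℤ) : ℝ) ≤ ((⌈X - τ⌉ - ⌊-X - τ⌋ - 1).toNat : ℤ) := by
    exact_mod_cast Int.self_le_toNat _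
  push_cast at h3 ⊢
  linarith

lemma card_shiftBall_le (τ : ℝ) {X : ℝ} (hX : 0 ≤ X) : ((shiftBall τ X).card : ℝ) ≤ 2 * X + 1 := by
  rw [shiftBall, Int.card_Ioo]
  have h1 := Int.lt_floor_add_one (-X - τ)
  have h2 := Int.ceil_lt_add_one (X - τ)
  rcases le_total 0 (⌈X - τ⌉ - ⌊-X - τ⌋ - 1) with h | h
  · have h3 : (((⌈X - τ⌉ - ⌊-X - τ⌋ - 1).toNat : ℤ) : ℝ)
        = ((⌈X - τ⌉ - ⌊-X - τ⌋ - 1 : ℤ) : ℝ) := by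
      exact_mod_cast Int.toNat_of_nonneg h
    push_cast at h3
    linarith
  · rw [Int.toNat_of_nonpos h]; push_cast; linarith

lemma exists_mul_sq_le_sqForm (nrm : Seminorm ℝ (Fin 3 → ℝ)) (hnrm : ∀ v, nrm v = 0 → v = 0) :
    ∃ c > 0, ∀ n, ∀ z ∈ halfShell n, c * (n : ℝ) ^ 2 ≤ nrm (sqForm z.1 z.2) := by
  obtain ⟨c, hc, h⟩ := nrm.exists_mul_abs_le hnrm
  refine ⟨c, hc, fun n z hz => ?_⟩
  obtain ⟨-, -, -, -, hn | hn⟩ := bounds_of_mem_halfShell hz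
  · have h2 := h (sqForm z.1 z.2) 2
    have : |sqForm z.1 z.2 2| = (n : ℝ) ^ 2 := by
      simp only [sqForm, Matrix.cons_val, abs_pow]
      rw [← hn, Nat.cast_natAbs, Int.cast_abs]
    rwa [this] at h2
  · have h2 := h (sqForm z.1 z.2) 0
    have : |sqForm z.1 z.2 0| = (n : ℝ) ^ 2 := by
      simp only [sqForm, Matrix.cons_val, abs_pow]
      rw [← hn, Nat.cast_natAbs, Int.cast_abs]
    rwa [this] at h2

lemma lineCoord_bezout {n : ℕ} {z : ℤ × ℤ} (hz : z ∈ halfShell n) (s t δ k : ℤ) :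
    lineCoord z (δ * s + k * z.2) (δ * t - k * z.1)
      = k + δ * (((s : ℝ) * z.2 - t * z.1) / ((z.1 : ℝ) ^ 2 + (z.2 : ℝ) ^ 2)) := by
  obtain ⟨hn, -, -, hD, -⟩ := bounds_of_mem_halfShell hz
  have hD' : (0 : ℝ) < (z.1 : ℝ) ^ 2 + (z.2 : ℝ) ^ 2 := by
    have : (0 : ℤ) < z.1 ^ 2 + z.2 ^ 2 := lt_of_lt_of_le (by positivity) hD
    exact_mod_cast this
  rw [lineCoord]
  field_simp
  push_cast
  ring

lemma prodForm_injective {n : ℕ} {z : ℤ × ℤ} (hz : z ∈ primShell n) {p r p' r' : ℤ}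
    (h : prodForm z p r = prodForm z p' r') : p = p' ∧ r = r' := by
  obtain ⟨s, t, hst⟩ := exists_bezout_of_mem_primShell hz
  have h0 := congrFun h 0
  have h1 := congrFun h 1
  have h2 := congrFun h 2
  simp only [prodForm, Matrix.cons_val] at h0 h1 h2
  obtain ⟨x, y⟩ := z
  simp only at h0 h1 h2 hst
  constructor
  · linear_combination (-(x * s + y * t + 1) * (p - p')) * hst + (2 * x * s * t + y * t ^ 2) * h0
      - x * s ^ 2 * h1 - y * s ^ 2 * h2
  · linear_combination (-(x * s + y * t + 1) * (r - r')) * hst - (2 * y * s * t + x * s ^ 2) * h2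
      + y * t ^ 2 * h1 + x * t ^ 2 * h0

lemma abs_lineCoord_le_of_other_root {n m : ℕ} {z w : ℤ × ℤ} {p r δ : ℤ} (hz : z ∈ primShell n)
    (hw : w ∈ primShell m) (hmn : m ≤ n) (hδ : z.1 * p + z.2 * r = δ) (hδ0 : δ ≠ 0)
    (h : p * w.1 + r * w.2 = 0) : |lineCoord z p r| ≤ 2 * |(δ : ℝ)| := by
  obtain ⟨s, t, hst⟩ := exists_bezout_of_mem_primShell hw
  have hp : p = (p * t - r * s) * w.2 := by linear_combination (-p) * hst + s * h
  have hr : r = -(p * t - r * s) * w.1 := by linear_combination (-r) * hst + t * h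
  set g := p * t - r * s
  have hg : |g| ≤ |δ| := by
    have : g ∣ δ := ⟨z.1 * w.2 - z.2 * w.1, by rw [← hδ, hp, hr]; ring⟩
    exact Int.le_of_dvd (abs_pos.2 hδ0) ((abs_dvd_abs _ _).2 this)
  obtain ⟨hn, hx, hy, hD, -⟩ := bounds_of_mem_halfShell (Finset.mem_filter.1 hz).1
  obtain ⟨-, hwx, hwy, -, -⟩ := bounds_of_mem_halfShell (Finset.mem_filter.1 hw).1
  have hmn' : (m : ℤ) ≤ n := by exact_mod_cast hmn
  have hp' : |p| ≤ |δ| * n := by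
    rw [hp, abs_mul]; exact mul_le_mul hg (hwy.trans hmn') (abs_nonneg _) (abs_nonneg _)
  have hr' : |r| ≤ |δ| * n := by
    rw [hr, abs_mul, abs_neg]; exact mul_le_mul hg (hwx.trans hmn') (abs_nonneg _) (abs_nonneg _)
  have hD0 : (0 : ℤ) < z.1 ^ 2 + z.2 ^ 2 := lt_of_lt_of_le (by positivity) hD
  have key : |p * z.2 - r * z.1| ≤ 2 * |δ| * (z.1 ^ 2 + z.2 ^ 2) := by
    calc |p * z.2 - r * z.1| ≤ |p * z.2| + |r * z.1| := abs_sub _ _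
      _ ≤ |δ| * n * n + |δ| * n * n := by
        rw [abs_mul, abs_mul]; gcongr
      _ = 2 * |δ| * (n : ℤ) ^ 2 := by ring
      _ ≤ _ := by gcongr
  have hD' : (0 : ℝ) < (z.1 : ℝ) ^ 2 + (z.2 : ℝ) ^ 2 := by exact_mod_cast hD0
  rw [lineCoord, abs_div, abs_of_pos hD', div_le_iff₀ hD']
  exact_mod_cast key

lemma exists_sq_le_of_isFormRoot_min (nrm : Seminorm ℝ (Fin 3 → ℝ))
    (hnrm : ∀ v, nrm v = 0 → v = 0) {d : ℤ} (hd : d ≠ 0) :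
    ∃ K > 0, ∀ T : ℝ, 1 ≤ T → ∀ q : Fin 3 → ℤ, (q 1) ^ 2 - 4 * (q 0) * (q 2) = d ^ 2 →
      nrm (fun i => (q i : ℝ)) < T → ∀ n, ∀ z ∈ primShell n, IsFormRoot q z →
      (∀ m, ∀ w ∈ primShell m, IsFormRoot q w → n ≤ m) → (n : ℝ) ^ 2 ≤ K * T := by
  obtain ⟨c, hc, hN⟩ := exists_mul_sq_le_sqForm nrm hnrm
  obtain ⟨B, hB, hform⟩ := exists_abs_prodForm_sub_le nrm
  have hdpos : 0 < |(d : ℝ)| := abs_pos.2 (by exact_mod_cast hd)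
  refine ⟨2 * (1 + |(d : ℝ)| * B) / c + 2 * |(d : ℝ)|, by positivity, ?_⟩
  intro T hT q hq hqT n z hz hroot hmin
  obtain ⟨p, r, rfl⟩ := eq_prodForm_of_isFormRoot hz hroot
  rw [disc_prodForm] at hq
  have hzs := (Finset.mem_filter.1 hz).1
  obtain ⟨hn, hx, hy, hD, -⟩ := bounds_of_mem_halfShell hzs
  have habs : |((z.1 * p + z.2 * r : ℤ) : ℝ)| = |(d : ℝ)| := by
    exact_mod_cast sq_eq_sq_iff_abs_eq_abs _ _ |>.1 hq
  have hpr : r ≠ 0 ∨ -p ≠ 0 := by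
    by_contra! h
    rw [h.1, neg_eq_zero.1 h.2] at hq
    exact pow_ne_zero 2 hd (by linear_combination -hq)
  obtain ⟨m, w, hw, g, hg, hr, hp⟩ := exists_mem_primShell hpr
  have hnm : n ≤ m := hmin m w hw
    (isFormRoot_prodForm.2 (Or.inr (by linear_combination w.2 * hr - w.1 * hp)))
  have hbig : (n : ℤ) ≤ |p| ∨ (n : ℤ) ≤ |r| := by
    have hg1 : 1 ≤ |g| := Int.one_le_abs hg
    obtain ⟨-, -, -, -, hm | hm⟩ := bounds_of_mem_halfShell (Finset.mem_filter.1 hw).1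
    · right
      rw [hr, abs_mul, Int.abs_eq_natAbs w.1, hm]
      nlinarith [(by exact_mod_cast hnm : (n : ℤ) ≤ m)]
    · left
      rw [← abs_neg p, hp, abs_mul, Int.abs_eq_natAbs w.2, hm]
      nlinarith [(by exact_mod_cast hnm : (n : ℤ) ≤ m)]
  have hn0 : (0 : ℝ) < n := by exact_mod_cast hn
  have hxR : |(z.1 : ℝ)| ≤ n := by exact_mod_cast hx
  have hyR : |(z.2 : ℝ)| ≤ n := by exact_mod_cast hy
  have hDR : (n : ℝ) ^ 2 ≤ (z.1 : ℝ) ^ 2 + (z.2 : ℝ) ^ 2 := by exact_mod_cast hD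
  have hD' : (0 : ℝ) < (z.1 : ℝ) ^ 2 + (z.2 : ℝ) ^ 2 := lt_of_lt_of_le (by positivity) hDR
  have hest := hform n z hzs p r
  rw [habs] at hest
  set τ := lineCoord z p r with hτ
  set D := (z.1 : ℝ) ^ 2 + (z.2 : ℝ) ^ 2 with hDdef
  have hτD : τ * D = p * z.2 - r * z.1 := by
    rw [hτ, lineCoord, ← hDdef]; field_simp
  have hDτ : D ≤ |(d : ℝ)| + |τ| * D := by
    have hbound : ∀ e u v : ℝ, (n : ℝ) ≤ |e| → |u| ≤ n → |v| ≤ n →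
        |e * D| ≤ |(d : ℝ)| * |u| + |τ| * D * |v| → D ≤ |(d : ℝ)| + |τ| * D := by
      intro e u v he hu hv h
      rw [abs_mul, abs_of_pos hD'] at h
      have h1 : (n : ℝ) * D ≤ |(d : ℝ)| * n + |τ| * D * n := by
        calc (n : ℝ) * D ≤ |e| * D := by gcongr
          _ ≤ _ := h
          _ ≤ _ := by gcongr
      nlinarith
    rcases hbig with h | h
    · refine hbound p z.1 z.2 (by exact_mod_cast h) hxR hyR ?_
      have : (p : ℝ) * D = ((z.1 * p + z.2 * r : ℤ) : ℝ) * z.1 + τ * D * z.2 := by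
        rw [hτD, hDdef]; push_cast; ring
      rw [this, ← habs]
      refine (abs_add_le _ _).trans (le_of_eq ?_)
      rw [abs_mul, abs_mul, abs_mul, abs_of_pos hD']
    · refine hbound r z.2 z.1 (by exact_mod_cast h) hyR hxR ?_
      have : (r : ℝ) * D = ((z.1 * p + z.2 * r : ℤ) : ℝ) * z.2 - τ * D * z.1 := by
        rw [hτD, hDdef]; push_cast; ring
      rw [this, ← habs]
      refine (abs_sub _ _).trans (le_of_eq ?_)
      rw [abs_mul, abs_mul, abs_mul, abs_of_pos hD']
  have hfin : (n : ℝ) ^ 2 ≤ 2 * (T + |(d : ℝ)| * B) / c + 2 * |(d : ℝ)| := by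
    rcases le_total (1 / 2) |τ| with h | h
    · have h1 : 1 / 2 * (c * (n : ℝ) ^ 2) ≤ T + |(d : ℝ)| * B := by
        calc 1 / 2 * (c * (n : ℝ) ^ 2) ≤ |τ| * nrm (sqForm z.1 z.2) :=
              mul_le_mul h (hN n z hzs) (by positivity) (abs_nonneg _)
          _ ≤ _ := by linarith [(abs_le.1 hest).1]
      have h2 : (n : ℝ) ^ 2 ≤ 2 * (T + |(d : ℝ)| * B) / c := by
        rw [le_div_iff₀ hc]; linarith
      linarith
    · have : 0 ≤ 2 * (T + |(d : ℝ)| * B) / c := by positivity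
      nlinarith
  refine hfin.trans ?_
  rw [add_mul, div_mul_eq_mul_div]
  have : |(d : ℝ)| * B ≤ |(d : ℝ)| * B * T := le_mul_of_one_le_right (by positivity) hT
  have h1 : 2 * (T + |(d : ℝ)| * B) / c ≤ 2 * (1 + |(d : ℝ)| * B) * T / c :=
    div_le_div_of_nonneg_right (by linarith) hc.le
  have h2 : 2 * |(d : ℝ)| ≤ 2 * |(d : ℝ)| * T := le_mul_of_one_le_right (by positivity) hT
  exact add_le_add h1 h2

lemma exists_abs_card_fiber_sub_le (nrm : Seminorm ℝ (Fin 3 → ℝ))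
    (hnrm : ∀ v, nrm v = 0 → v = 0) {d : ℤ} (hd : d ≠ 0) (ρ : (Fin 3 → ℤ) → ℤ × ℤ)
    (hρ : ∀ q : Fin 3 → ℤ, (q 1) ^ 2 - 4 * (q 0) * (q 2) = d ^ 2 → ∃ n, ρ q ∈ primShell n ∧
      IsFormRoot q (ρ q) ∧ ∀ m, ∀ w ∈ primShell m, IsFormRoot q w → n ≤ m) :
    ∃ C, ∀ (T : ℝ) (S : Finset (Fin 3 → ℤ)), 0 ≤ T →
      (∀ q, q ∈ S ↔ (q 1) ^ 2 - 4 * (q 0) * (q 2) = d ^ 2 ∧ nrm (fun i => (q i : ℝ)) < T) →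
      ∀ n, ∀ z ∈ primShell n,
        |((S.filter fun q => ρ q = z).card : ℝ) - 4 * T * (1 / nrm (sqForm z.1 z.2))| ≤ C := by
  obtain ⟨c, hc, hN⟩ := exists_mul_sq_le_sqForm nrm hnrm
  obtain ⟨B, hB, hform⟩ := exists_abs_prodForm_sub_le nrm
  refine ⟨4 * (|(d : ℝ)| * B / c) + 8 * |(d : ℝ)| + 8, ?_⟩
  intro T S hT hS n z hz
  have hzs := (Finset.mem_filter.1 hz).1
  obtain ⟨s, t, hst⟩ := exists_bezout_of_mem_primShell hz
  obtain ⟨hn, -, -, -, -⟩ := bounds_of_mem_halfShell hzs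
  set N := nrm (sqForm z.1 z.2) with hNdef
  have hNc : c ≤ N := by
    have h1 : (1 : ℝ) ≤ n := by exact_mod_cast hn
    have h2 := hN n z hzs
    have h3 : c * 1 ≤ c * (n : ℝ) ^ 2 := by gcongr; exact one_le_pow₀ h1
    linarith
  have hN0 : 0 < N := hc.trans_le hNc
  set C := |(d : ℝ)| * B with hC
  have hC0 : 0 ≤ C := by positivity
  have hCN : C / N ≤ C / c := by gcongr
  set κ : ℝ := ((s : ℝ) * z.2 - t * z.1) / ((z.1 : ℝ) ^ 2 + (z.2 : ℝ) ^ 2) with hκ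
  set P : (Σ _ : ℤ, ℤ) → (Fin 3 → ℤ) :=
    fun a => prodForm z (a.1 * s + a.2 * z.2) (a.1 * t - a.2 * z.1) with hP
  set Δ : Finset ℤ := {d, -d} with hΔ
  have hΔcard : ∀ f : ℤ → ℝ, ∑ δ ∈ Δ, f δ = f d + f (-d) := fun f =>
    Finset.sum_pair (by omega)
  have hΔabs : ∀ δ ∈ Δ, |(δ : ℝ)| = |(d : ℝ)| ∧ δ ^ 2 = d ^ 2 ∧ δ ≠ 0 := by
    intro δ hδ
    rcases Finset.mem_insert.1 hδ with rfl | hδ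
    · exact ⟨rfl, rfl, hd⟩
    · rw [Finset.mem_singleton.1 hδ]; exact ⟨by simp, by ring, by simpa⟩
  have hdet : ∀ δ k : ℤ, z.1 * (δ * s + k * z.2) + z.2 * (δ * t - k * z.1) = δ := by
    intro δ k; linear_combination δ * hst
  have hnP : ∀ δ ∈ Δ, ∀ k : ℤ,
      |nrm (fun i => (P ⟨δ, k⟩ i : ℝ)) - |(k : ℝ) + δ * κ| * N| ≤ C := by
    intro δ hδ k
    have h := hform n z hzs (δ * s + k * z.2) (δ * t - k * z.1)
    rwa [hdet, lineCoord_bezout hzs, (hΔabs δ hδ).1] at h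
  have hupper : ((S.filter fun q => ρ q = z).card : ℝ) ≤ 2 * (2 * ((T + C) / N) + 1) := by
    have hsub : (S.filter fun q => ρ q = z) ⊆
        (Δ.sigma fun δ => shiftBall (δ * κ) ((T + C) / N)).image P := by
      intro q hq
      obtain ⟨hqS, hqz⟩ := Finset.mem_filter.1 hq
      obtain ⟨hdisc, hqT⟩ := (hS q).1 hqS
      obtain ⟨_, -, hroot, -⟩ := hρ q hdisc
      rw [hqz] at hroot
      obtain ⟨p, r, rfl⟩ := eq_prodForm_of_isFormRoot hz hroot
      rw [disc_prodForm] at hdisc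
      have hδ : z.1 * p + z.2 * r ∈ Δ := by
        rcases sq_eq_sq_iff_eq_or_eq_neg.1 hdisc with h | h <;> simp [hΔ, h]
      have hPeq : P ⟨z.1 * p + z.2 * r, p * t - r * s⟩ = prodForm z p r := by
        simp only [hP]
        congr 1
        · linear_combination p * hst
        · linear_combination r * hst
      refine Finset.mem_image.2 ⟨⟨z.1 * p + z.2 * r, p * t - r * s⟩,
        Finset.mem_sigma.2 ⟨hδ, ?_⟩, hPeq⟩
      rw [mem_shiftBall, lt_div_iff₀ hN0]
      have h := hnP _ hδ (p * t - r * s)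
      rw [hPeq] at h
      linarith [(abs_le.1 h).1]
    have h1 := (Finset.card_le_card hsub).trans Finset.card_image_le
    rw [Finset.card_sigma] at h1
    have h2 : ((S.filter fun q => ρ q = z).card : ℝ)
        ≤ ∑ δ ∈ Δ, ((shiftBall (δ * κ) ((T + C) / N)).card : ℝ) := by exact_mod_cast h1
    rw [hΔcard] at h2
    have hX : 0 ≤ (T + C) / N := by positivity
    linarith [card_shiftBall_le ((d : ℝ) * κ) hX, card_shiftBall_le (((-d : ℤ) : ℝ) * κ) hX]
  have hlower : 2 * (2 * ((T - C) / N) - 1) - 2 * (2 * (2 * |(d : ℝ)| + 1) + 1)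
      ≤ ((S.filter fun q => ρ q = z).card : ℝ) := by
    have hsub : (Δ.sigma fun δ => shiftBall (δ * κ) ((T - C) / N) \
        shiftBall (δ * κ) (2 * |(d : ℝ)| + 1)).image P ⊆ (S.filter fun q => ρ q = z) := by
      intro q hq
      obtain ⟨⟨δ, k⟩, hmem, rfl⟩ := Finset.mem_image.1 hq
      obtain ⟨hδ, hk⟩ := Finset.mem_sigma.1 hmem
      simp only at hδ hk
      obtain ⟨hk1, hk2⟩ := Finset.mem_sdiff.1 hk
      rw [mem_shiftBall, lt_div_iff₀ hN0] at hk1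
      obtain ⟨hδ1, hδ2, hδ0⟩ := hΔabs δ hδ
      have hdisc : (P ⟨δ, k⟩ 1) ^ 2 - 4 * (P ⟨δ, k⟩ 0) * (P ⟨δ, k⟩ 2) = d ^ 2 := by
        simp only [hP]
        rw [disc_prodForm, hdet, hδ2]
      refine Finset.mem_filter.2 ⟨(hS _).2 ⟨hdisc, ?_⟩, ?_⟩
      · linarith [(abs_le.1 (hnP δ hδ k)).2]
      · by_contra hne
        obtain ⟨m, hw, hroot, hmin⟩ := hρ _ hdisc
        have hmn : m ≤ n := hmin n z hz (isFormRoot_prodForm.2 (Or.inl (by ring)))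
        rcases isFormRoot_prodForm.1 hroot with h | h
        · exact hne (eq_of_mem_primShell hz hw h).symm
        · have h1 := abs_lineCoord_le_of_other_root hz hw hmn (hdet δ k) hδ0 h
          rw [lineCoord_bezout hzs, hδ1] at h1
          apply hk2
          rw [mem_shiftBall]
          exact h1.trans_lt (lt_add_one _)
    have hinj : Function.Injective P := by
      rintro ⟨δ, k⟩ ⟨δ', k'⟩ h
      obtain ⟨h1, h2⟩ := prodForm_injective hz h
      simp only at h1 h2
      obtain rfl : δ = δ' := by
        rw [← hdet δ k, ← hdet δ' k', h1, h2]
      obtain rfl : k = k' := by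
        linear_combination (k' - k) * hst + t * h1 - s * h2
      rfl
    have h1 := Finset.card_le_card hsub
    rw [Finset.card_image_of_injective _ hinj, Finset.card_sigma] at h1
    have h2 : ∑ δ ∈ Δ, ((shiftBall (δ * κ) ((T - C) / N) \
        shiftBall (δ * κ) (2 * |(d : ℝ)| + 1)).card : ℝ)
          ≤ ((S.filter fun q => ρ q = z).card : ℝ) := by exact_mod_cast h1
    rw [hΔcard] at h2
    have hδ : ∀ δ : ℤ, (2 * ((T - C) / N) - 1) - (2 * (2 * |(d : ℝ)| + 1) + 1)
        ≤ ((shiftBall (δ * κ) ((T - C) / N) \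
          shiftBall (δ * κ) (2 * |(d : ℝ)| + 1)).card : ℝ) := by
      intro δ
      have h3 : ((shiftBall (δ * κ) ((T - C) / N)).card : ℝ)
          ≤ (shiftBall (δ * κ) ((T - C) / N) \ shiftBall (δ * κ) (2 * |(d : ℝ)| + 1)).card
            + (shiftBall (δ * κ) (2 * |(d : ℝ)| + 1)).card := by
        exact_mod_cast Finset.card_le_card_sdiff_add_card
      have h4 := le_card_shiftBall (δ * κ) ((T - C) / N)
      have h5 := card_shiftBall_le ((δ : ℝ) * κ) (show 0 ≤ 2 * |(d : ℝ)| + 1 by positivity)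
      linarith
    linarith [hδ d, hδ (-d)]
  rw [add_div] at hupper
  rw [sub_div] at hlower
  rw [mul_one_div, mul_div_assoc, abs_le]
  constructor <;> linarith [abs_nonneg (d : ℝ)]

lemma finite_setOf_disc_eq (nrm : Seminorm ℝ (Fin 3 → ℝ)) (hnrm : ∀ v, nrm v = 0 → v = 0)
    (d : ℤ) (T : ℝ) :
    {x : Fin 3 → ℤ | (x 1) ^ 2 - 4 * (x 0) * (x 2) = d ^ 2 ∧
      nrm (fun i => (x i : ℝ)) < T}.Finite := by
  obtain ⟨c, hc, h⟩ := nrm.exists_mul_abs_le hnrm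
  refine (Set.finite_Icc (fun _ : Fin 3 => -⌈T / c⌉) (fun _ => ⌈T / c⌉)).subset ?_
  rintro x ⟨-, hx⟩
  have hi : ∀ i, |x i| ≤ ⌈T / c⌉ := by
    intro i
    have h1 : |(x i : ℝ)| ≤ T / c := by
      rw [le_div_iff₀ hc, mul_comm]
      exact (h (fun i => (x i : ℝ)) i).trans hx.le
    exact_mod_cast h1.trans (Int.le_ceil _)
  exact ⟨fun i => (abs_le.1 (hi i)).1, fun i => (abs_le.1 (hi i)).2⟩

lemma card_primShell_le (n : ℕ) : (primShell n).card ≤ 4 * n := by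
  refine (Finset.card_filter_le _ _).trans ((Finset.card_union_le _ _).trans ?_)
  refine (add_le_add Finset.card_image_le Finset.card_image_le).trans ?_
  simp only [Finset.card_range]
  omega

lemma disjoint_primShell {n m : ℕ} (h : n ≠ m) : Disjoint (primShell n) (primShell m) := by
  rw [Finset.disjoint_left]
  intro z hz hz'
  have h1 := mem_halfShell.1 (Finset.mem_filter.1 hz).1
  have h2 := mem_halfShell.1 (Finset.mem_filter.1 hz').1
  omega

lemma tendsto_log_floor_sqrt {K : ℝ} (hK : 0 < K) :
    Tendsto (fun T : ℝ => Real.log (⌊√(K * T)⌋₊ : ℝ) / Real.log T) atTop (𝓝 (1 / 2)) := by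
  have hs : Tendsto (fun T : ℝ => √(K * T)) atTop atTop :=
    Real.tendsto_sqrt_atTop.comp (tendsto_id.const_mul_atTop hK)
  have h1 : Tendsto (fun T : ℝ => Real.log ((⌊√(K * T)⌋₊ : ℝ) / √(K * T))) atTop (𝓝 0) := by
    have := (tendsto_nat_floor_div_atTop (R := ℝ)).comp hs
    have h := this.log one_ne_zero
    rwa [Real.log_one] at h
  have h2 := ((h1.add_const (Real.log K / 2)).div_atTop Real.tendsto_log_atTop).add_const (1 / 2)
  rw [zero_add] at h2
  refine h2.congr' ?_
  filter_upwards [eventually_gt_atTop 1, hs.eventually_ge_atTop 1] with T hT hsT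
  have hl : 0 < Real.log T := Real.log_pos hT
  have hf : (⌊√(K * T)⌋₊ : ℝ) ≠ 0 := by
    have := Nat.floor_pos.2 hsT
    positivity
  have hs0 : √(K * T) ≠ 0 := by positivity
  rw [Real.log_div hf hs0, Real.log_sqrt (by positivity), Real.log_mul hK.ne' (by positivity)]
  field_simp
  ring

/-- the number of integral binary quadratic forms `ax² + bxy + cy²`
of discriminant `d²` with `‖(a,b,c)‖ < T` is asymptotic to `c₀·T·log T`. -/
theorem count_binary_quadratic_forms_square_discriminant
    (d : ℤ) (hd : d ≠ 0)
    (nrm : Seminorm ℝ (Fin 3 → ℝ)) (hnrm : ∀ v, nrm v = 0 → v = 0) :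
    ∃ c₀ > (0:ℝ),
      Tendsto (fun T : ℝ =>
          (Set.ncard {x : Fin 3 → ℤ |
              (x 1)^2 - 4 * (x 0) * (x 2) = d^2 ∧
              nrm (fun i => (x i : ℝ)) < T} : ℝ) / (T * Real.log T))
        atTop (𝓝 c₀) := by
  classical
  set H : ℝ → ℝ → ℝ := fun x y => 1 / nrm (sqForm x y) with hH
  have hpos : ∀ x y : ℝ, (x ≠ 0 ∨ y ≠ 0) → 0 < nrm (sqForm x y) := by
    intro x y hxy
    refine lt_of_le_of_ne (apply_nonneg _ _) fun h => ?_
    have h0 := hnrm _ h.symm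
    have hy := congrFun h0 0
    have hx := congrFun h0 2
    simp [sqForm] at hx hy
    tauto
  have hcont : ∀ f g : ℝ → ℝ, Continuous f → Continuous g → (∀ t, f t ≠ 0 ∨ g t ≠ 0) →
      Continuous fun t => H (f t) (g t) := by
    intro f g hf hg hne
    refine continuous_const.div (nrm.continuous_fin_three.comp ?_) fun t => (hpos _ _ (hne t)).ne'
    refine continuous_pi fun i => ?_
    fin_cases i <;> simp [sqForm] <;> fun_prop
  obtain ⟨c, hc, hlim⟩ := exists_tendsto_sum_primShell_div_log (H := H)
    (fun a x y _ => by
      simp only [hH, sqForm_mul, map_smul_eq_mul, Real.norm_eq_abs, abs_pow, sq_abs]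
      rw [one_div, mul_inv, one_div, div_eq_mul_inv, mul_comm])
    (hcont (fun _ => 1) id continuous_const continuous_id fun _ => Or.inl one_ne_zero)
    (hcont id (fun _ => 1) continuous_id continuous_const fun _ => Or.inr one_ne_zero)
    (fun x y => one_div_nonneg.2 (apply_nonneg _ _))
    (fun t => one_div_pos.2 (hpos _ _ (Or.inl one_ne_zero)))
    (fun t => one_div_pos.2 (hpos _ _ (Or.inr one_ne_zero)))
  have hex : ∀ q : Fin 3 → ℤ, ∃ z : ℤ × ℤ, (q 1) ^ 2 - 4 * (q 0) * (q 2) = d ^ 2 →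
      ∃ n, z ∈ primShell n ∧ IsFormRoot q z ∧
        ∀ m, ∀ w ∈ primShell m, IsFormRoot q w → n ≤ m := by
    intro q
    by_cases h : (q 1) ^ 2 - 4 * (q 0) * (q 2) = d ^ 2
    · obtain ⟨z, hz⟩ := exists_min_isFormRoot h
      exact ⟨z, fun _ => hz⟩
    · exact ⟨0, fun h' => absurd h' h⟩
  choose ρ hρ using hex
  obtain ⟨C, hC⟩ := exists_abs_card_fiber_sub_le nrm hnrm hd ρ hρ
  obtain ⟨K, hK, hheight⟩ := exists_sq_le_of_isFormRoot_min nrm hnrm hd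
  set M : ℝ → ℕ := fun T => ⌊√(K * T)⌋₊ with hM
  set G : ℕ → ℝ := fun M => ∑ n ∈ Finset.Ioc 0 M, ∑ w ∈ primShell n, H w.1 w.2 with hG
  set Q : ℝ → ℝ := fun T => (Set.ncard {x : Fin 3 → ℤ |
    (x 1)^2 - 4 * (x 0) * (x 2) = d^2 ∧ nrm (fun i => (x i : ℝ)) < T} : ℝ) with hQ
  have hmain : ∀ T, 1 ≤ T → |Q T - 4 * T * G (M T)| ≤ 4 * |C| * K * T := by
    intro T hT
    have hfin := finite_setOf_disc_eq nrm hnrm d T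
    set S := hfin.toFinset with hSdef
    have hS : ∀ q, q ∈ S ↔ (q 1) ^ 2 - 4 * (q 0) * (q 2) = d ^ 2 ∧
        nrm (fun i => (q i : ℝ)) < T := fun q => by simp [hSdef]
    have hmaps : ∀ q ∈ S, ρ q ∈ (Finset.Ioc 0 (M T)).biUnion primShell := by
      intro q hq
      obtain ⟨hdisc, hqT⟩ := (hS q).1 hq
      obtain ⟨n, hn, hroot, hmin⟩ := hρ q hdisc
      refine Finset.mem_biUnion.2 ⟨n, Finset.mem_Ioc.2
        ⟨(bounds_of_mem_halfShell (Finset.mem_filter.1 hn).1).1, ?_⟩, hn⟩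
      exact Nat.le_floor (Real.le_sqrt_of_sq_le
        (hheight T hT q hdisc hqT n (ρ q) hn hroot hmin))
    have hcard : Q T = ∑ n ∈ Finset.Ioc 0 (M T), ∑ z ∈ primShell n,
        ((S.filter fun q => ρ q = z).card : ℝ) := by
      simp only [hQ]
      rw [Set.ncard_eq_toFinset_card _ hfin, Finset.card_eq_sum_card_fiberwise hmaps,
        Finset.sum_biUnion fun n _ m _ h => disjoint_primShell h]
      push_cast
      rfl
    rw [hcard, hG, Finset.mul_sum, ← Finset.sum_sub_distrib]
    calc _ ≤ ∑ n ∈ Finset.Ioc 0 (M T), 4 * (M T : ℝ) * |C| := by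
          refine (Finset.abs_sum_le_sum_abs _ _).trans (Finset.sum_le_sum fun n hn => ?_)
          rw [Finset.mul_sum, ← Finset.sum_sub_distrib]
          refine (Finset.abs_sum_le_sum_abs _ _).trans ?_
          refine (Finset.sum_le_sum fun z hz =>
            (hC T S (by linarith) hS n z hz).trans (le_abs_self C)).trans ?_
          rw [Finset.sum_const, nsmul_eq_mul]
          have h1 : (primShell n).card ≤ 4 * M T :=
            (card_primShell_le n).trans (Nat.mul_le_mul_left 4 (Finset.mem_Ioc.1 hn).2)
          gcongr
          exact_mod_cast h1
      _ = 4 * |C| * (M T : ℝ) ^ 2 := by simp; ring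
      _ ≤ 4 * |C| * (K * T) := by
          gcongr
          have hKT : 0 ≤ K * T := by positivity
          calc (M T : ℝ) ^ 2 ≤ √(K * T) ^ 2 := by
                gcongr; exact Nat.floor_le (Real.sqrt_nonneg _)
            _ = K * T := Real.sq_sqrt hKT
      _ = _ := by ring
  refine ⟨4 * c * (1 / 2), by positivity, ?_⟩
  have hMtop : Tendsto M atTop atTop :=
    tendsto_nat_floor_atTop.comp
      (Real.tendsto_sqrt_atTop.comp (tendsto_id.const_mul_atTop hK))
  have hG' : Tendsto (fun T => 4 * (G (M T) / Real.log (M T)) * (Real.log (M T) / Real.log T))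
      atTop (𝓝 (4 * c * (1 / 2))) :=
    ((hlim.comp hMtop).const_mul 4).mul (tendsto_log_floor_sqrt hK)
  have herr : Tendsto (fun T => (Q T - 4 * T * G (M T)) / (T * Real.log T)) atTop (𝓝 0) := by
    have hz : Tendsto (fun T => 4 * |C| * K / Real.log T) atTop (𝓝 0) :=
      tendsto_const_nhds.div_atTop Real.tendsto_log_atTop
    refine squeeze_zero_norm' ?_ hz
    filter_upwards [eventually_gt_atTop 1] with T hT
    have hl : 0 < Real.log T := Real.log_pos hT
    rw [Real.norm_eq_abs, abs_div, abs_of_pos (show 0 < T * Real.log T by positivity),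
      div_le_div_iff₀ (by positivity) hl]
    calc _ ≤ 4 * |C| * K * T * Real.log T := by gcongr; exact hmain T hT.le
      _ = _ := by ring
  have := herr.add hG'
  rw [zero_add] at this
  refine this.congr' ?_
  filter_upwards [eventually_gt_atTop 1, hMtop.eventually_gt_atTop 1] with T hT hMT
  have hl : Real.log T ≠ 0 := (Real.log_pos hT).ne'
  have hl' : Real.log (M T : ℝ) ≠ 0 := (Real.log_pos (by exact_mod_cast hMT)).ne'
  have hT0 : T ≠ 0 := by positivity
  field_simp
  ring
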